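/- Let n = n1 + n2 with n1, n2 positive integers, X an n × d real matrix, A an n × m real matrix, w* ∈ ℝ^d, v* ∈ ℝ^m, σ > 0, and γ* the n × n diagonal matrix whose first n1 diagonal entries are 1 and last n2 diagonal entries are 0. Let ε ~ N(0, σ² I_n) and y = γ* X w* + (I − γ*) A v* + ε. Let γ be an n × n diagonal matrix with diagonal entries in {0, 1}, set δ* = X w* − A v*, Δ_γ = γ* − γ, Q1 = Xᵀ γ* X, X̄ = γ X, Ā = (I − γ) A, assume ĀᵀĀ invertible, let Π̄_a = Ā (ĀᵀĀ)^{-1} Āᵀ, X̄_a = (I − Π̄_a) X̄, assume Q̄_a = X̄_aᵀ X̄_a invertible, and let H̄ = Q̄_a^{-1} X̄_aᵀ and w1 = H̄ y. Then, with R(θ) = (1/n1) ‖γ* X (θ − w*)‖² + σ², it holds that E_ε[ R(w1) ] = (1/n1) ‖γ* X H̄ Δ_γ δ*‖² + (σ²/n1) tr( Q̄_a^{-1} Q1 ) + σ². -/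

import Mathlib

open MeasureTheory ProbabilityTheory Matrix

section GaussianMoments

variable {ι κ : Type*} [Fintype ι] [Fintype κ]

lemma memLp_const_add_dotProduct_gaussian (v : NNReal) (a : ι → ℝ) (b : ℝ) :
    MemLp (fun ε : ι → ℝ => b + a ⬝ᵥ ε) 2 (Measure.pi fun _ : ι => gaussianReal 0 v) := by
  refine (memLp_const b).add (memLp_finsetSum _ fun i _ => ?_)
  exact ((memLp_id_gaussianReal' 2 (by simp)).comp_measurePreserving
    (measurePreserving_eval (fun _ : ι => gaussianReal 0 v) i)).const_mul (a i)

lemma integral_const_add_dotProduct_gaussian (v : NNReal) (a : ι → ℝ) (b : ℝ) :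
    ∫ ε : ι → ℝ, (b + a ⬝ᵥ ε) ∂(Measure.pi fun _ : ι => gaussianReal 0 v) = b := by
  have hint (i : ι) : Integrable (fun ε : ι → ℝ => a i * ε i)
      (Measure.pi fun _ : ι => gaussianReal 0 v) :=
    (((memLp_id_gaussianReal' 2 (by simp)).comp_measurePreserving
      (measurePreserving_eval (fun _ : ι => gaussianReal 0 v) i)).const_mul (a i)).integrable
        one_le_two
  have hmean (i : ι) : ∫ ε : ι → ℝ, ε i ∂(Measure.pi fun _ : ι => gaussianReal 0 v) = 0 := by
    rw [integral_comp_eval (μ := fun _ : ι => gaussianReal 0 v) (f := fun x : ℝ => x)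
      measurable_id.aestronglyMeasurable]
    exact integral_id_gaussianReal
  simp only [dotProduct]
  rw [integral_add (integrable_const b) (integrable_finsetSum _ fun i _ => hint i),
    integral_finsetSum _ fun i _ => hint i]
  simp [integral_const_mul, hmean]

lemma variance_const_add_dotProduct_gaussian (v : NNReal) (a : ι → ℝ) (b : ℝ) :
    Var[fun ε : ι → ℝ => b + a ⬝ᵥ ε; Measure.pi fun _ : ι => gaussianReal 0 v]
      = v * (a ⬝ᵥ a) := by
  have hL (i : ι) : MemLp (fun x : ℝ => a i * x) 2 (gaussianReal 0 v) :=
    (memLp_id_gaussianReal' 2 (by simp)).const_mul (a i)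
  have hmeas : AEStronglyMeasurable (fun ε : ι → ℝ => a ⬝ᵥ ε)
      (Measure.pi fun _ : ι => gaussianReal 0 v) := by
    simpa using (memLp_const_add_dotProduct_gaussian v a 0).aestronglyMeasurable
  rw [variance_const_add hmeas]
  have hvar (i : ι) : Var[fun x : ℝ => a i * x; gaussianReal 0 v] = a i ^ 2 * v :=
    (variance_const_mul (a i) (fun x : ℝ => x) _).trans (by rw [variance_fun_id_gaussianReal])
  calc _ = _ := by
        congr 1
        ext ε
        simp only [dotProduct, Finset.sum_apply]
    _ = ∑ i, Var[fun x : ℝ => a i * x; gaussianReal 0 v] := variance_sum_pi hL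
    _ = _ := by
        simp only [hvar]
        rw [dotProduct, Finset.mul_sum]
        exact Finset.sum_congr rfl fun i _ => by ring

lemma integral_sq_const_add_dotProduct_gaussian (v : NNReal) (a : ι → ℝ) (b : ℝ) :
    ∫ ε : ι → ℝ, (b + a ⬝ᵥ ε) ^ 2 ∂(Measure.pi fun _ : ι => gaussianReal 0 v)
      = b ^ 2 + v * (a ⬝ᵥ a) := by
  have h := variance_eq_sub (memLp_const_add_dotProduct_gaussian v a b)
  rw [variance_const_add_dotProduct_gaussian, integral_const_add_dotProduct_gaussian] at h
  simp only [Pi.pow_apply] at h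
  linarith

lemma integrable_sum_sq_add_mulVec_gaussian (v : NNReal) (M : Matrix κ ι ℝ) (b : κ → ℝ) :
    Integrable (fun ε : ι → ℝ => ∑ k, ((b + M *ᵥ ε) k) ^ 2)
      (Measure.pi fun _ : ι => gaussianReal 0 v) :=
  integrable_finsetSum _ fun k _ =>
    (memLp_const_add_dotProduct_gaussian v (M k) (b k)).integrable_sq

lemma integral_sum_sq_add_mulVec_gaussian (v : NNReal) (M : Matrix κ ι ℝ) (b : κ → ℝ) :
    ∫ ε : ι → ℝ, ∑ k, ((b + M *ᵥ ε) k) ^ 2 ∂(Measure.pi fun _ : ι => gaussianReal 0 v)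
      = ∑ k, b k ^ 2 + v * (M * Mᵀ).trace := by
  calc _ = ∑ k, ∫ ε : ι → ℝ, (b k + M k ⬝ᵥ ε) ^ 2 ∂(Measure.pi fun _ : ι => gaussianReal 0 v) :=
        integral_finsetSum _ fun k _ =>
          (memLp_const_add_dotProduct_gaussian v (M k) (b k)).integrable_sq
    _ = ∑ k, (b k ^ 2 + v * (M k ⬝ᵥ M k)) :=
        Finset.sum_congr rfl fun k _ => integral_sq_const_add_dotProduct_gaussian v (M k) (b k)
    _ = _ := by
        rw [Finset.sum_add_distrib, ← Finset.mul_sum]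
        rfl

end GaussianMoments

section Projection

variable {ι κ : Type*} [Fintype ι] [Fintype κ] [DecidableEq κ]

lemma transpose_columnProjection (B : Matrix ι κ ℝ) :
    (B * (Bᵀ * B)⁻¹ * Bᵀ)ᵀ = B * (Bᵀ * B)⁻¹ * Bᵀ := by
  simp [transpose_mul, transpose_nonsing_inv, Matrix.mul_assoc]

lemma columnProjection_mul_self {B : Matrix ι κ ℝ} (hB : IsUnit (Bᵀ * B).det) :
    B * (Bᵀ * B)⁻¹ * Bᵀ * B = B := by
  rw [Matrix.mul_assoc, Matrix.mul_assoc, nonsing_inv_mul _ hB, Matrix.mul_one]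

end Projection

/-- Risk of the Pi-DUAL estimator:
`E_ε[R(w1)] = (1/n1) ‖γ* X H̄ Δ_γ δ*‖² + (σ²/n1) tr(Q̄_a⁻¹ Q1) + σ²`. -/
theorem pidual_risk
    (n1 n2 d m : ℕ) (hn1 : 0 < n1) (hn2 : 0 < n2)
    (X : Matrix (Fin (n1 + n2)) (Fin d) ℝ)
    (A : Matrix (Fin (n1 + n2)) (Fin m) ℝ)
    (ws : Fin d → ℝ) (vs : Fin m → ℝ) (σ : ℝ) (hσ : 0 < σ)
    (γs : Matrix (Fin (n1 + n2)) (Fin (n1 + n2)) ℝ)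
    (hγs : γs = Matrix.diagonal (fun i : Fin (n1 + n2) =>
      if (i : ℕ) < n1 then (1 : ℝ) else 0))
    (g : Fin (n1 + n2) → ℝ) (hg : ∀ i, g i = 0 ∨ g i = 1)
    (γ : Matrix (Fin (n1 + n2)) (Fin (n1 + n2)) ℝ) (hγ : γ = Matrix.diagonal g)
    (δs : Fin (n1 + n2) → ℝ) (hδ : δs = X.mulVec ws - A.mulVec vs)
    (Δγ : Matrix (Fin (n1 + n2)) (Fin (n1 + n2)) ℝ) (hΔ : Δγ = γs - γ)
    (Q1 : Matrix (Fin d) (Fin d) ℝ) (hQ1 : Q1 = Xᵀ * γs * X)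
    (Xb : Matrix (Fin (n1 + n2)) (Fin d) ℝ) (hXb : Xb = γ * X)
    (Ab : Matrix (Fin (n1 + n2)) (Fin m) ℝ) (hAb : Ab = (1 - γ) * A)
    (hAinv : IsUnit (Abᵀ * Ab).det)
    (Pa : Matrix (Fin (n1 + n2)) (Fin (n1 + n2)) ℝ)
    (hPa : Pa = Ab * (Abᵀ * Ab)⁻¹ * Abᵀ)
    (Xa : Matrix (Fin (n1 + n2)) (Fin d) ℝ) (hXa : Xa = (1 - Pa) * Xb)
    (Qa : Matrix (Fin d) (Fin d) ℝ) (hQa : Qa = Xaᵀ * Xa) (hQainv : IsUnit Qa.det)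
    (H : Matrix (Fin d) (Fin (n1 + n2)) ℝ) (hH : H = Qa⁻¹ * Xaᵀ)
    (y : (Fin (n1 + n2) → ℝ) → Fin (n1 + n2) → ℝ)
    (hy : ∀ ε, y ε = (γs * X).mulVec ws + ((1 - γs) * A).mulVec vs + ε)
    (w1 : (Fin (n1 + n2) → ℝ) → Fin d → ℝ)
    (hw1 : ∀ ε, w1 ε = H.mulVec (y ε))
    (R : (Fin d → ℝ) → ℝ)
    (hR : ∀ θ, R θ = ((1 : ℝ) / n1) * ∑ i, ((γs * X).mulVec (θ - ws) i) ^ 2 + σ ^ 2) :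
    ∫ ε : Fin (n1 + n2) → ℝ, R (w1 ε)
      ∂(Measure.pi fun _ : Fin (n1 + n2) => gaussianReal 0 ⟨σ ^ 2, sq_nonneg σ⟩)
    = ((1 : ℝ) / n1) * ∑ i, ((γs * X * H * Δγ).mulVec δs i) ^ 2
      + (σ ^ 2 / n1) * (Qa⁻¹ * Q1).trace + σ ^ 2 := by
  have hPt : Paᵀ = Pa := by rw [hPa]; exact transpose_columnProjection Ab
  have hPA : Pa * Ab = Ab := by rw [hPa]; exact columnProjection_mul_self hAinv
  have hPP : Pa * Pa = Pa := by
    nth_rewrite 2 [hPa]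
    rw [← Matrix.mul_assoc, ← Matrix.mul_assoc, hPA, ← hPa]
  have hXaA : Xaᵀ * Ab = 0 := by
    rw [hXa, transpose_mul, transpose_sub, transpose_one, hPt, Matrix.mul_assoc,
      Matrix.sub_mul, Matrix.one_mul, hPA, sub_self, Matrix.mul_zero]
  have hXaP : Xaᵀ * (1 - Pa) = Xaᵀ := by
    rw [hXa, transpose_mul, transpose_sub, transpose_one, hPt, Matrix.mul_assoc]
    congr 1
    rw [Matrix.sub_mul, Matrix.one_mul, Matrix.mul_sub, Matrix.mul_one, hPP, sub_self, sub_zero]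
  have hXaX : Xaᵀ * Xb = Qa := by
    rw [hQa]
    nth_rewrite 3 [hXa]
    rw [← Matrix.mul_assoc, hXaP]
  have hHX : H * Xb = 1 := by rw [hH, Matrix.mul_assoc, hXaX, nonsing_inv_mul _ hQainv]
  have hHA : H * Ab = 0 := by rw [hH, Matrix.mul_assoc, hXaA, Matrix.mul_zero]
  have hQt : Qaᵀ = Qa := by rw [hQa, transpose_mul, transpose_transpose]
  have hHH : H * Hᵀ = Qa⁻¹ := by
    rw [hH, transpose_mul, transpose_transpose, transpose_nonsing_inv, hQt, Matrix.mul_assoc,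
      ← Matrix.mul_assoc Xaᵀ, ← hQa, mul_nonsing_inv _ hQainv, Matrix.mul_one]
  have hγt : γsᵀ = γs := by rw [hγs, diagonal_transpose]
  have hγγ : γs * γs = γs := by
    rw [hγs, diagonal_mul_diagonal]
    congr 1
    ext i
    split_ifs <;> simp
  have hsignal : (γs * X) *ᵥ ws + ((1 - γs) * A) *ᵥ vs
      = Xb *ᵥ ws + Ab *ᵥ vs + Δγ *ᵥ δs := by
    rw [hXb, hAb, hΔ, hδ]
    simp only [← mulVec_mulVec, sub_mulVec, mulVec_sub, one_mulVec]
    abel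
  have herr (ε : Fin (n1 + n2) → ℝ) :
      (γs * X) *ᵥ (w1 ε - ws) = (γs * X * H * Δγ) *ᵥ δs + (γs * X * H) *ᵥ ε := by
    have hw : w1 ε - ws = H *ᵥ (Δγ *ᵥ δs) + H *ᵥ ε := by
      rw [hw1, hy, hsignal]
      simp only [mulVec_add, mulVec_mulVec, hHX, hHA, one_mulVec, zero_mulVec]
      abel
    rw [hw, mulVec_add, mulVec_mulVec, mulVec_mulVec, mulVec_mulVec, Matrix.mul_assoc _ H]
  have htrace : (γs * X * H * (γs * X * H)ᵀ).trace = (Qa⁻¹ * Q1).trace := by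
    calc (γs * X * H * (γs * X * H)ᵀ).trace
        = (γs * X * (H * Hᵀ) * (γs * X)ᵀ).trace := by
          rw [transpose_mul (γs * X) H]
          simp only [Matrix.mul_assoc]
      _ = (Qa⁻¹ * ((γs * X)ᵀ * (γs * X))).trace := by
          rw [hHH, trace_mul_comm, ← Matrix.mul_assoc, trace_mul_comm]
      _ = (Qa⁻¹ * Q1).trace := by
          rw [transpose_mul, hγt, Matrix.mul_assoc Xᵀ, ← Matrix.mul_assoc γs, hγγ, hQ1,
            Matrix.mul_assoc Xᵀ]
  simp only [hR, herr]
  have hrisk (v : NNReal) : ∫ ε : Fin (n1 + n2) → ℝ, ((1 : ℝ) / n1 *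
        ∑ i, (((γs * X * H * Δγ) *ᵥ δs + (γs * X * H) *ᵥ ε) i) ^ 2 + σ ^ 2)
        ∂(Measure.pi fun _ : Fin (n1 + n2) => gaussianReal 0 v)
      = (1 : ℝ) / n1 * (∑ i, ((γs * X * H * Δγ) *ᵥ δs) i ^ 2
        + v * (Qa⁻¹ * Q1).trace) + σ ^ 2 := by
    rw [integral_add ((integrable_sum_sq_add_mulVec_gaussian _ _ _).const_mul _)
      (integrable_const _), integral_const_mul, integral_sum_sq_add_mulVec_gaussian, htrace]
    simp
  refine (hrisk ⟨σ ^ 2, sq_nonneg σ⟩).trans ?_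
  change (1 : ℝ) / n1 * (_ + σ ^ 2 * _) + σ ^ 2 = _
  ring
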